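/- Let V be a finite-dimensional real vector space. Let 𝓡 be the space of curvature-like tensors on V: 4-linear forms R on V satisfying R(u,v,w,z) = −R(v,u,w,z) = −R(u,v,z,w) = R(w,z,u,v) and the first Bianchi identity R(u,v,w,z) + R(u,w,z,v) + R(u,z,v,w) = 0. Let N₂ be the space of 4-linear forms T on V that are symmetric in the first two arguments, symmetric in the last two arguments, and satisfy T(u,v,w,z) + T(u,z,v,w) + T(u,w,z,v) = 0 (vanishing cyclic sum over the last three arguments). Then the linear map Φ : 𝓡 → N₂ defined by Φ(R)(u,v,w,z) := −(1/3)(R(u,w,v,z) + R(u,z,v,w)) is well defined and is an ℝ-linear isomorphism from 𝓡 onto N₂. -/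

import Mathlib

set_option synthInstance.maxHeartbeats 1000000
set_option maxHeartbeats 1000000

noncomputable section

/-- The space `𝓡` of curvature-like tensors on `V`: 4-linear forms `R` with
`R(u,v,w,z) = −R(v,u,w,z) = −R(u,v,z,w) = R(w,z,u,v)` satisfying the first Bianchi
identity. -/
def curvatureLikeTensors (V : Type*) [AddCommGroup V] [Module ℝ V] :
    Submodule ℝ (V →ₗ[ℝ] V →ₗ[ℝ] V →ₗ[ℝ] V →ₗ[ℝ] ℝ) where
  carrier := {R |
    (∀ u v w z : V, R u v w z = - R v u w z) ∧
    (∀ u v w z : V, R u v w z = - R u v z w) ∧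
    (∀ u v w z : V, R u v w z = R w z u v) ∧
    (∀ u v w z : V, R u v w z + R u w z v + R u z v w = 0)}
  add_mem' := by
    rintro R S ⟨h1, h2, h3, h4⟩ ⟨k1, k2, k3, k4⟩
    refine ⟨fun u v w z => ?_, fun u v w z => ?_, fun u v w z => ?_, fun u v w z => ?_⟩ <;>
      simp only [LinearMap.add_apply]
    · linarith [h1 u v w z, k1 u v w z]
    · linarith [h2 u v w z, k2 u v w z]
    · linarith [h3 u v w z, k3 u v w z]
    · linarith [h4 u v w z, k4 u v w z]
  zero_mem' := by
    refine ⟨fun u v w z => ?_, fun u v w z => ?_, fun u v w z => ?_, fun u v w z => ?_⟩ <;> simp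
  smul_mem' := by
    rintro r R ⟨h1, h2, h3, h4⟩
    refine ⟨fun u v w z => ?_, fun u v w z => ?_, fun u v w z => ?_, fun u v w z => ?_⟩ <;>
      simp only [LinearMap.smul_apply, smul_eq_mul]
    · linear_combination r * h1 u v w z
    · linear_combination r * h2 u v w z
    · linear_combination r * h3 u v w z
    · linear_combination r * h4 u v w z

/-- The space `N₂` of normal tensors of order 2 on `V`: 4-linear forms symmetric in the
first two and in the last two arguments whose cyclic sum over the last three arguments
vanishes. -/
def normalTensors2 (V : Type*) [AddCommGroup V] [Module ℝ V] :
    Submodule ℝ (V →ₗ[ℝ] V →ₗ[ℝ] V →ₗ[ℝ] V →ₗ[ℝ] ℝ) where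
  carrier := {T |
    (∀ u v w z : V, T u v w z = T v u w z) ∧
    (∀ u v w z : V, T u v w z = T u v z w) ∧
    (∀ u v w z : V, T u v w z + T u z v w + T u w z v = 0)}
  add_mem' := by
    rintro T S ⟨h1, h2, h3⟩ ⟨k1, k2, k3⟩
    refine ⟨fun u v w z => ?_, fun u v w z => ?_, fun u v w z => ?_⟩ <;>
      simp only [LinearMap.add_apply]
    · linarith [h1 u v w z, k1 u v w z]
    · linarith [h2 u v w z, k2 u v w z]
    · linarith [h3 u v w z, k3 u v w z]
  zero_mem' := by
    refine ⟨fun u v w z => ?_, fun u v w z => ?_, fun u v w z => ?_⟩ <;> simp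
  smul_mem' := by
    rintro r T ⟨h1, h2, h3⟩
    refine ⟨fun u v w z => ?_, fun u v w z => ?_, fun u v w z => ?_⟩ <;>
      simp only [LinearMap.smul_apply, smul_eq_mul]
    · linear_combination r * h1 u v w z
    · linear_combination r * h2 u v w z
    · linear_combination r * h3 u v w z

/-- 4-linear forms on `V`. -/
abbrev FourForm (V : Type*) [AddCommGroup V] [Module ℝ V] : Type _ :=
  V →ₗ[ℝ] V →ₗ[ℝ] V →ₗ[ℝ] V →ₗ[ℝ] ℝ

/-- Swap the second and third arguments. -/
def swapMid {V : Type*} [AddCommGroup V] [Module ℝ V] (R : FourForm V) : FourForm V where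
  toFun u := (R u).flip
  map_add' a b := by ext; simp
  map_smul' a b := by ext; simp

/-- Swap the last two arguments. -/
def swapLast {V : Type*} [AddCommGroup V] [Module ℝ V] (R : FourForm V) : FourForm V where
  toFun u :=
    { toFun := fun v => (R u v).flip
      map_add' := fun a b => by ext; simp
      map_smul' := fun a b => by ext; simp }
  map_add' a b := by ext; simp
  map_smul' a b := by ext; simp

theorem swapMid_apply {V : Type*} [AddCommGroup V] [Module ℝ V] (R : FourForm V)
    (u v w z : V) : swapMid R u v w z = R u w v z := rfl

theorem swapLast_apply {V : Type*} [AddCommGroup V] [Module ℝ V] (R : FourForm V)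
    (u v w z : V) : swapLast R u v w z = R u v z w := rfl

/-- The map `Φ` on all 4-linear forms. -/
def phiForm {V : Type*} [AddCommGroup V] [Module ℝ V] (R : FourForm V) : FourForm V :=
  (-(1/3 : ℝ)) • (swapMid R + swapLast (swapMid R))

/-- The inverse of `Φ`, on all 4-linear forms. -/
def psiForm {V : Type*} [AddCommGroup V] [Module ℝ V] (T : FourForm V) : FourForm V :=
  swapLast (swapMid T) + (-1 : ℝ) • swapMid T

theorem phiForm_apply {V : Type*} [AddCommGroup V] [Module ℝ V] (R : FourForm V)
    (u v w z : V) : phiForm R u v w z = -(1/3 : ℝ) * (R u w v z + R u z v w) := rfl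

theorem psiForm_apply {V : Type*} [AddCommGroup V] [Module ℝ V] (T : FourForm V)
    (u v w z : V) : psiForm T u v w z = T u z v w - T u w v z := by
  change T u z v w + (-1 : ℝ) * T u w v z = _
  ring

theorem phiForm_mem {V : Type*} [AddCommGroup V] [Module ℝ V] {R : FourForm V}
    (hR : R ∈ curvatureLikeTensors V) : phiForm R ∈ normalTensors2 V := by
  obtain ⟨h1, h2, h3, h4⟩ := hR
  refine ⟨fun u v w z => ?_, fun u v w z => ?_, fun u v w z => ?_⟩ <;>
    simp only [phiForm_apply]
  · linarith [h3 u w v z, h3 u z v w]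
  · ring
  · linarith [h2 u w v z, h2 u v w z, h2 u z v w]

/-- Normal tensors of order 2 are symmetric under exchange of the two pairs. -/
theorem normal_pair_symm {V : Type*} [AddCommGroup V] [Module ℝ V] {T : FourForm V}
    (hT : T ∈ normalTensors2 V) (u v w z : V) : T u v w z = T w z u v := by
  obtain ⟨h1, h2, h3⟩ := hT
  linarith [h3 u v w z, h3 v u w z, h3 w u v z, h3 z u v w,
    h1 u v w z, h1 u w v z, h1 u z v w, h1 v w u z, h1 v z u w, h1 w z u v,
    h2 u v w z, h2 u w v z, h2 u z v w, h2 v w u z, h2 v z u w, h2 w z u v,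
    h1 u v z w, h1 u w z v, h1 u z w v, h1 v w z u, h1 v z w u, h1 w z v u,
    h2 v u w z, h2 w u v z, h2 z u v w, h2 w v u z, h2 z v u w, h2 z w u v]

theorem psiForm_mem {V : Type*} [AddCommGroup V] [Module ℝ V] {T : FourForm V}
    (hT : T ∈ normalTensors2 V) : psiForm T ∈ curvatureLikeTensors V := by
  have hp := normal_pair_symm hT
  obtain ⟨h1, h2, h3⟩ := hT
  refine ⟨fun u v w z => ?_, fun u v w z => ?_, fun u v w z => ?_, fun u v w z => ?_⟩ <;>
    simp only [psiForm_apply]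
  · linarith [hp u z v w, hp u w v z, h1 v w u z, h1 v z u w, h2 v w u z, h2 v z u w,
      h1 v w z u, h1 v z w u, h1 w v u z, h1 z v u w, h2 w v u z, h2 z v u w]
  · ring
  · linarith [hp w v z u, h1 z u w v, h2 u z w v, h1 w u z v, h2 u w z v]
  · linarith [h2 u z v w, h2 u w v z, h2 u v w z]

theorem psi_phi {V : Type*} [AddCommGroup V] [Module ℝ V] {R : FourForm V}
    (hR : R ∈ curvatureLikeTensors V) : psiForm (phiForm R) = R := by
  obtain ⟨h1, h2, h3, h4⟩ := hR
  ext u v w z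
  simp only [psiForm_apply, phiForm_apply]
  linarith [h4 u v w z, h2 u v w z, h2 u w v z, h2 u z v w]

theorem phi_psi {V : Type*} [AddCommGroup V] [Module ℝ V] {T : FourForm V}
    (hT : T ∈ normalTensors2 V) : phiForm (psiForm T) = T := by
  obtain ⟨h1, h2, h3⟩ := hT
  ext u v w z
  simp only [psiForm_apply, phiForm_apply]
  linarith [h3 u v w z, h2 u v w z, h2 u w v z, h2 u z v w]

/-- the map `Φ(R)(u,v,w,z) = −(1/3)(R(u,w,v,z) + R(u,z,v,w))` is a
well-defined `ℝ`-linear isomorphism from the space `𝓡` of curvature-like tensors onto the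
space `N₂` of normal tensors of order 2. -/
theorem curvatureLikeTensors_equiv_normalTensors2
    (V : Type*) [AddCommGroup V] [Module ℝ V] [FiniteDimensional ℝ V] :
    ∃ Φ : curvatureLikeTensors V ≃ₗ[ℝ] normalTensors2 V,
      ∀ (R : curvatureLikeTensors V) (u v w z : V),
        (Φ R : V →ₗ[ℝ] V →ₗ[ℝ] V →ₗ[ℝ] V →ₗ[ℝ] ℝ) u v w z =
          -(1/3 : ℝ) * ((R : V →ₗ[ℝ] V →ₗ[ℝ] V →ₗ[ℝ] V →ₗ[ℝ] ℝ) u w v z +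
            (R : V →ₗ[ℝ] V →ₗ[ℝ] V →ₗ[ℝ] V →ₗ[ℝ] ℝ) u z v w) := by
  refine ⟨{
    toFun := fun R => ⟨phiForm R.1, phiForm_mem R.2⟩
    invFun := fun T => ⟨psiForm T.1, psiForm_mem T.2⟩
    left_inv := fun R => Subtype.ext (psi_phi R.2)
    right_inv := fun T => Subtype.ext (phi_psi T.2)
    map_add' := ?_
    map_smul' := ?_ }, fun R u v w z => phiForm_apply R.1 u v w z⟩
  · intro R S
    apply Subtype.ext
    ext u v w z
    simp only [Submodule.coe_add, LinearMap.add_apply, phiForm_apply]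
    ring
  · intro c R
    apply Subtype.ext
    ext u v w z
    simp only [Submodule.coe_smul, LinearMap.smul_apply, phiForm_apply, smul_eq_mul,
      RingHom.id_apply]
    ring
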